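/- arXiv:math/0409036 — 3 statements merged into one kernel-verified Lean document; each statement's English description precedes it below -/
import Mathlib

section
/- Let 𝒜 be a finite affine hyperplane arrangement in ℝ^d and let F, P ∈ 𝓕(𝒜) be faces. Then there exists a unique face Q ∈ 𝓕(𝒜) such that for every x ∈ F and every y ∈ P there is ε₀ > 0 with x + ε(y − x) ∈ Q for all 0 < ε < ε₀. (This face Q is the composition F ∘ P of the faces F and P.) -/
open CategoryTheory

attribute [local instance] Classical.propDecidable

noncomputable section

/-! ### Hyperplane arrangements -/

/-- `H` is an affine hyperplane in `ℝ^d`. -/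
def IsHyperplane {d : ℕ} (H : Set (Fin d → ℝ)) : Prop :=
  ∃ (a : Fin d → ℝ) (b : ℝ), a ≠ 0 ∧ H = {x | ∑ i, a i * x i = b}

/-- A finite affine hyperplane arrangement. -/
def IsArrangement {d : ℕ} (𝒜 : Finset (Set (Fin d → ℝ))) : Prop :=
  ∀ H ∈ 𝒜, IsHyperplane H

/-- The union of the hyperplanes of the arrangement. -/
def ArrUnion {d : ℕ} (𝒜 : Finset (Set (Fin d → ℝ))) : Set (Fin d → ℝ) :=
  ⋃ H ∈ 𝒜, (H : Set (Fin d → ℝ))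

/-- `x` and `y` lie on the same side of `H` (same connected component of the complement). -/
def SameSide {d : ℕ} (H : Set (Fin d → ℝ)) (x y : Fin d → ℝ) : Prop :=
  connectedComponentIn Hᶜ x = connectedComponentIn Hᶜ y

/-- The (relatively open) stratum of the point `x`: all points lying on exactly the same
hyperplanes as `x` and on the same side of all other hyperplanes. -/
def faceOf {d : ℕ} (𝒜 : Finset (Set (Fin d → ℝ))) (x : Fin d → ℝ) : Set (Fin d → ℝ) :=
  {y | ∀ H ∈ 𝒜, (x ∈ H ↔ y ∈ H) ∧ (x ∉ H → SameSide H x y)}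

/-- The faces of the arrangement: the relatively open strata of the stratification of `ℝ^d`
induced by `𝒜`. -/
def Faces {d : ℕ} (𝒜 : Finset (Set (Fin d → ℝ))) : Set (Set (Fin d → ℝ)) :=
  {F | ∃ x, F = faceOf 𝒜 x}

/-- A chamber: a connected component of the complement of the arrangement. -/
def IsChamber {d : ℕ} (𝒜 : Finset (Set (Fin d → ℝ))) (C : Set (Fin d → ℝ)) : Prop :=
  ∃ x, x ∉ ArrUnion 𝒜 ∧ C = connectedComponentIn (ArrUnion 𝒜)ᶜ x

/-- The order of the face poset: `F₁ ≥ F₂` iff `closure F₁ ⊆ closure F₂`. -/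
def FaceGE {d : ℕ} (F₁ F₂ : Set (Fin d → ℝ)) : Prop :=
  closure F₁ ⊆ closure F₂

/-- Strict version of the face-poset order. -/
def FaceGT {d : ℕ} (F₁ F₂ : Set (Fin d → ℝ)) : Prop :=
  FaceGE F₁ F₂ ∧ F₁ ≠ F₂

/-- The characterizing property of the composition `F ∘ P` of two faces: `Q` contains all
points `x + ε (y - x)`, for `x ∈ F`, `y ∈ P` and all sufficiently small `ε > 0`. -/
def CompProp {d : ℕ} (F P Q : Set (Fin d → ℝ)) : Prop :=
  ∀ x ∈ F, ∀ y ∈ P, ∃ ε₀ > (0 : ℝ), ∀ ε : ℝ, 0 < ε → ε < ε₀ → x + ε • (y - x) ∈ Q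

/-- The composition `F ∘ P` of two faces: the unique face `Q` satisfying `CompProp F P Q`
(junk value `∅` if no unique such face exists). -/
def faceComp {d : ℕ} (𝒜 : Finset (Set (Fin d → ℝ))) (F P : Set (Fin d → ℝ)) :
    Set (Fin d → ℝ) :=
  if h : ∃! Q, Q ∈ Faces 𝒜 ∧ CompProp F P Q then h.choose else ∅

/-- `H` separates the (chambers) `A` and `B`. -/
def Separates {d : ℕ} (H A B : Set (Fin d → ℝ)) : Prop :=
  ∃ x ∈ A, ∃ y ∈ B, x ∉ H ∧ y ∉ H ∧ ¬ SameSide H x y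

/-- Two chambers are adjacent if exactly one hyperplane of `𝒜` separates them. -/
def Adjacent {d : ℕ} (𝒜 : Finset (Set (Fin d → ℝ))) (A B : Set (Fin d → ℝ)) : Prop :=
  ∃! H, H ∈ 𝒜 ∧ Separates H A B

/-! ### Oriented graphs and walks -/

/-- An oriented graph: vertices, edges, source and target maps. -/
structure OrientedGraph : Type 1 where
  V : Type
  E : Type
  src : E → V
  tgt : E → V

namespace OrientedGraph

variable (G : OrientedGraph)

/-- Start vertex of a signed edge (an edge traversed forwards (`true`) or backwards). -/
def stepSrc : G.E × Bool → G.V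
  | (e, true) => G.src e
  | (e, false) => G.tgt e

/-- End vertex of a signed edge. -/
def stepTgt : G.E × Bool → G.V
  | (e, true) => G.tgt e
  | (e, false) => G.src e

/-- The list of signed edges `l` forms a walk starting at `v`. -/
def WalkFrom : G.V → List (G.E × Bool) → Prop
  | _, [] => True
  | v, s :: l => G.stepSrc s = v ∧ WalkFrom (G.stepTgt s) l

/-- The final vertex of a walk. -/
def walkEnd : G.V → List (G.E × Bool) → G.V
  | v, [] => v
  | _, s :: l => walkEnd (G.stepTgt s) l

/-- The list of vertices visited by a walk. -/
def visits : G.V → List (G.E × Bool) → List G.V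
  | v, [] => [v]
  | v, s :: l => v :: visits (G.stepTgt s) l

theorem walkEnd_append : ∀ (l₁ l₂ : List (G.E × Bool)) (v : G.V),
    G.walkEnd v (l₁ ++ l₂) = G.walkEnd (G.walkEnd v l₁) l₂
  | [], _, _ => rfl
  | s :: l₁, l₂, _ => walkEnd_append l₁ l₂ (G.stepTgt s)

theorem walkFrom_append : ∀ (l₁ l₂ : List (G.E × Bool)) (v : G.V),
    G.WalkFrom v l₁ → G.WalkFrom (G.walkEnd v l₁) l₂ → G.WalkFrom v (l₁ ++ l₂)
  | [], _, _, _, h₂ => h₂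
  | _ :: l₁, l₂, _, h₁, h₂ => ⟨h₁.1, walkFrom_append l₁ l₂ _ h₁.2 h₂⟩

/-- Reversal of a signed edge. -/
def flipStep (s : G.E × Bool) : G.E × Bool := (s.1, !s.2)

theorem stepSrc_flip (s : G.E × Bool) : G.stepSrc (G.flipStep s) = G.stepTgt s := by
  rcases s with ⟨e, _ | _⟩ <;> rfl

theorem stepTgt_flip (s : G.E × Bool) : G.stepTgt (G.flipStep s) = G.stepSrc s := by
  rcases s with ⟨e, _ | _⟩ <;> rfl

/-- The list of signed edges of the inverse walk. -/
def invList (l : List (G.E × Bool)) : List (G.E × Bool) := (l.map G.flipStep).reverse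

theorem invList_cons (s : G.E × Bool) (l : List (G.E × Bool)) :
    G.invList (s :: l) = G.invList l ++ [G.flipStep s] := by
  simp [invList]

theorem walkEnd_inv : ∀ (l : List (G.E × Bool)) (v : G.V), G.WalkFrom v l →
    G.walkEnd (G.walkEnd v l) (G.invList l) = v
  | [], _, _ => rfl
  | s :: l, v, h => by
      rw [show G.walkEnd v (s :: l) = G.walkEnd (G.stepTgt s) l from rfl,
        G.invList_cons, G.walkEnd_append, walkEnd_inv l _ h.2]
      show G.stepTgt (G.flipStep s) = v
      rw [G.stepTgt_flip]; exact h.1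

theorem walkFrom_inv : ∀ (l : List (G.E × Bool)) (v : G.V), G.WalkFrom v l →
    G.WalkFrom (G.walkEnd v l) (G.invList l)
  | [], _, _ => trivial
  | s :: l, v, h => by
      rw [show G.walkEnd v (s :: l) = G.walkEnd (G.stepTgt s) l from rfl, G.invList_cons]
      refine G.walkFrom_append _ _ _ (walkFrom_inv l _ h.2) ?_
      rw [G.walkEnd_inv l _ h.2]
      exact ⟨G.stepSrc_flip s, trivial⟩

end OrientedGraph

/-- A walk in an oriented graph: a start vertex and a composable list of signed edges. -/
structure GWalk (G : OrientedGraph) where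
  start : G.V
  steps : List (G.E × Bool)
  valid : G.WalkFrom start steps

namespace GWalk

variable {G : OrientedGraph}

/-- The end vertex of a walk. -/
def endV (w : GWalk G) : G.V := G.walkEnd w.start w.steps

/-- The length of a walk. -/
def length (w : GWalk G) : ℕ := w.steps.length

/-- A walk is positive if all its edges are traversed forwards. -/
def Positive (w : GWalk G) : Prop := ∀ s ∈ w.steps, s.2 = true

/-- The vertices visited by a walk. -/
def vertices (w : GWalk G) : List G.V := G.visits w.start w.steps

/-- The constant walk at a vertex. -/
def nil (G : OrientedGraph) (v : G.V) : GWalk G := ⟨v, [], trivial⟩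

/-- Concatenation of walks (junk value `w₁` if the endpoints do not match). -/
def append' (w₁ w₂ : GWalk G) : GWalk G :=
  if h : w₁.endV = w₂.start then
    ⟨w₁.start, w₁.steps ++ w₂.steps,
      G.walkFrom_append _ _ _ w₁.valid
        (by rw [show G.walkEnd w₁.start w₁.steps = w₂.start from h]; exact w₂.valid)⟩
  else w₁

/-- The inverse walk. -/
def inv (w : GWalk G) : GWalk G := ⟨w.endV, G.invList w.steps, G.walkFrom_inv _ _ w.valid⟩

end GWalk

/-- A morphism of oriented graphs. -/
structure GraphMor (G H : OrientedGraph) where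
  onV : G.V → H.V
  onE : G.E → H.E
  src_comm : ∀ e, H.src (onE e) = onV (G.src e)
  tgt_comm : ∀ e, H.tgt (onE e) = onV (G.tgt e)

namespace GraphMor

variable {G H : OrientedGraph} (ρ : GraphMor G H)

/-- Image of a signed edge. -/
def mapStep (s : G.E × Bool) : H.E × Bool := (ρ.onE s.1, s.2)

theorem stepSrc_map (s : G.E × Bool) :
    H.stepSrc (ρ.mapStep s) = ρ.onV (G.stepSrc s) := by
  rcases s with ⟨e, _ | _⟩
  · exact ρ.tgt_comm e
  · exact ρ.src_comm e

theorem stepTgt_map (s : G.E × Bool) :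
    H.stepTgt (ρ.mapStep s) = ρ.onV (G.stepTgt s) := by
  rcases s with ⟨e, _ | _⟩
  · exact ρ.src_comm e
  · exact ρ.tgt_comm e

theorem walkFrom_map : ∀ (l : List (G.E × Bool)) (v : G.V),
    G.WalkFrom v l → H.WalkFrom (ρ.onV v) (l.map ρ.mapStep)
  | [], _, _ => trivial
  | s :: l, v, h => by
      refine ⟨?_, ?_⟩
      · rw [ρ.stepSrc_map, h.1]
      · rw [ρ.stepTgt_map]
        exact walkFrom_map l _ h.2

theorem walkEnd_map : ∀ (l : List (G.E × Bool)) (v : G.V),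
    H.walkEnd (ρ.onV v) (l.map ρ.mapStep) = ρ.onV (G.walkEnd v l)
  | [], _ => rfl
  | s :: l, v => by
      show H.walkEnd (H.stepTgt (ρ.mapStep s)) (l.map ρ.mapStep) = _
      rw [ρ.stepTgt_map]
      exact walkEnd_map l _

/-- Image of a walk under a morphism of oriented graphs. -/
def mapWalk (w : GWalk G) : GWalk H :=
  ⟨ρ.onV w.start, w.steps.map ρ.mapStep, ρ.walkFrom_map _ _ w.valid⟩

theorem mapWalk_start (w : GWalk G) : (ρ.mapWalk w).start = ρ.onV w.start := rfl

theorem mapWalk_endV (w : GWalk G) : (ρ.mapWalk w).endV = ρ.onV w.endV :=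
  ρ.walkEnd_map _ _

end GraphMor

/-- A positive walk of minimal length among the positive walks with the same endpoints. -/
def IsMinPos (G : OrientedGraph) (w : GWalk G) : Prop :=
  w.Positive ∧ ∀ w' : GWalk G, w'.start = w.start → w'.endV = w.endV → w'.Positive →
    w.length ≤ w'.length

/-- An oriented system: an oriented graph together with an equivalence relation on its
walks which is endpoint-preserving, cancellative and compatible with composition. -/
structure OrientedSystem (G : OrientedGraph) where
  rel : GWalk G → GWalk G → Prop
  rel_start : ∀ {α β}, rel α β → α.start = β.start
  rel_endV : ∀ {α β}, rel α β → α.endV = β.endV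
  rel_refl : ∀ α, rel α α
  rel_symm : ∀ {α β}, rel α β → rel β α
  rel_trans : ∀ {α β γ}, rel α β → rel β γ → rel α γ
  rel_cancel : ∀ α : GWalk G, rel (α.append' α.inv) (GWalk.nil G α.start)
  rel_inv : ∀ {α β}, rel α β → rel α.inv β.inv
  rel_comp : ∀ {α β : GWalk G} (γ₁ γ₂ : GWalk G), rel α β →
      γ₁.endV = α.start → α.endV = γ₂.start →
      rel ((γ₁.append' α).append' γ₂) ((γ₁.append' β).append' γ₂)

/-- The oriented system of an arrangement: the smallest oriented-system relation
identifying any two positive minimal walks with the same begin and end. -/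
def IsMinimalSystem (G : OrientedGraph) (S : OrientedSystem G) : Prop :=
  (∀ α β : GWalk G, α.start = β.start → α.endV = β.endV →
      IsMinPos G α → IsMinPos G β → S.rel α β) ∧
  ∀ S' : OrientedSystem G,
    (∀ α β : GWalk G, α.start = β.start → α.endV = β.endV →
        IsMinPos G α → IsMinPos G β → S'.rel α β) →
    ∀ α β, S.rel α β → S'.rel α β

/-- A cover of oriented systems: unique path lifting, preserving the identifications. -/
structure IsCoverOS {Θ Γ : OrientedGraph} (ρ : GraphMor Θ Γ)
    (SΘ : OrientedSystem Θ) (SΓ : OrientedSystem Γ) : Prop where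
  lift_exists_unique : ∀ (v : Θ.V) (α : GWalk Γ), α.start = ρ.onV v →
    ∃! α' : GWalk Θ, α'.start = v ∧ ρ.mapWalk α' = α
  lift_rel : ∀ (v : Θ.V) (α β : GWalk Γ), α.start = ρ.onV v → β.start = ρ.onV v →
    SΓ.rel α β → ∀ α' β' : GWalk Θ, α'.start = v → β'.start = v →
    ρ.mapWalk α' = α → ρ.mapWalk β' = β → SΘ.rel α' β'

/-- A connected oriented graph. -/
def GConnected (G : OrientedGraph) : Prop :=
  Nonempty G.V ∧ ∀ a b : G.V, ∃ w : GWalk G, w.start = a ∧ w.endV = b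

/-! ### The graph of chambers of an arrangement -/

/-- The oriented graph `Γ(𝒜)`: vertices are the chambers, with a directed edge in each
direction between each pair of adjacent chambers. -/
def chamberGraph {d : ℕ} (𝒜 : Finset (Set (Fin d → ℝ))) : OrientedGraph where
  V := {C : Set (Fin d → ℝ) // IsChamber 𝒜 C}
  E := {p : {C : Set (Fin d → ℝ) // IsChamber 𝒜 C} × {C : Set (Fin d → ℝ) // IsChamber 𝒜 C} //
    Adjacent 𝒜 p.1.1 p.2.1}
  src := fun e => e.1.1
  tgt := fun e => e.1.2

/-- The end vertex of the lift at `v` of a positive minimal walk from `ρ(v)` to `b`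
(junk value `v` if no such lift exists). -/
def liftEnd {d : ℕ} {𝒜 : Finset (Set (Fin d → ℝ))} {Θ : OrientedGraph}
    (ρ : GraphMor Θ (chamberGraph 𝒜)) (v : Θ.V) (b : (chamberGraph 𝒜).V) : Θ.V :=
  if h : ∃ γ : GWalk Θ, γ.start = v ∧ IsMinPos (chamberGraph 𝒜) (ρ.mapWalk γ) ∧
      (ρ.mapWalk γ).endV = b then
    h.choose.endV
  else v

/-! ### The poset limits of the diagrams -/

/-- Elements of the poset limit `Plim 𝒟_id`: pairs `(F, C)` with `F` a face, `C` a chamber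
and `F > C`. -/
def PlimIdMem {d : ℕ} (𝒜 : Finset (Set (Fin d → ℝ)))
    (p : Set (Fin d → ℝ) × Set (Fin d → ℝ)) : Prop :=
  p.1 ∈ Faces 𝒜 ∧ IsChamber 𝒜 p.2 ∧ FaceGT p.1 p.2

/-- The order of the poset limit `Plim 𝒟_id`:
`(F₁, C₁) ≥ (F₂, C₂)` iff `F₁ ≥ F₂` and `C₂ = (C₁)_{F₂}` (with `C₂ = C₁` when `F₁ = F₂`). -/
def PlimIdGE {d : ℕ} (𝒜 : Finset (Set (Fin d → ℝ)))
    (p q : Set (Fin d → ℝ) × Set (Fin d → ℝ)) : Prop :=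
  FaceGE p.1 q.1 ∧
    ((p.1 = q.1 ∧ p.2 = q.2) ∨ (p.1 ≠ q.1 ∧ q.2 = faceComp 𝒜 q.1 p.2))

/-- Elements of the poset limit `Plim 𝒟_ρ`: pairs `(F, v)` with `F` a face, `v` a vertex
of `Θ` and `F > ρ(v)`. -/
def PlimRhoMem {d : ℕ} (𝒜 : Finset (Set (Fin d → ℝ))) {Θ : OrientedGraph}
    (ρ : GraphMor Θ (chamberGraph 𝒜)) (p : Set (Fin d → ℝ) × Θ.V) : Prop :=
  p.1 ∈ Faces 𝒜 ∧ FaceGT p.1 (ρ.onV p.2).1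

/-- The order of the poset limit `Plim 𝒟_ρ`: `(F₁, v₁) ≥ (F₂, v₂)` iff `F₁ ≥ F₂` and
`v₂ = end(γ̂_{v₁}(ρ(v₁) → ρ(v₁)_{F₂}))` (with `v₂ = v₁` when `F₁ = F₂`). -/
def PlimRhoGE {d : ℕ} (𝒜 : Finset (Set (Fin d → ℝ))) {Θ : OrientedGraph}
    (ρ : GraphMor Θ (chamberGraph 𝒜)) (p q : Set (Fin d → ℝ) × Θ.V) : Prop :=
  FaceGE p.1 q.1 ∧
    ((p.1 = q.1 ∧ p.2 = q.2) ∨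
      (p.1 ≠ q.1 ∧ ∃ h : IsChamber 𝒜 (faceComp 𝒜 q.1 (ρ.onV p.2).1),
        q.2 = liftEnd ρ p.2 ⟨faceComp 𝒜 q.1 (ρ.onV p.2).1, h⟩))

/-! ### Geometric realization of order complexes -/

/-- The geometric realization of the order complex of the relation `r` on the set of
elements satisfying `S`: convex combinations (in `P → ℝ`, with the product topology)
whose supports are finite chains of elements satisfying `S`. -/
def ocg {P : Type} (S : P → Prop) (r : P → P → Prop) : Set (P → ℝ) :=
  {f | (∀ p, 0 ≤ f p) ∧
       (∃ s : Finset P, (∀ p ∉ s, f p = 0) ∧ ∑ p ∈ s, f p = 1) ∧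
       (∀ p, f p ≠ 0 → S p) ∧
       IsChain r {p | f p ≠ 0}}

/-- The vertex of the realization of an order complex corresponding to `p₀`. -/
def vtx {P : Type} (p₀ : P) : P → ℝ := fun p => if p = p₀ then 1 else 0

theorem vtx_mem {P : Type} {S : P → Prop} {r : P → P → Prop} {p₀ : P} (h : S p₀) :
    vtx p₀ ∈ ocg S r := by
  have hsupp : ∀ p : P, vtx p₀ p ≠ 0 → p = p₀ := by
    intro p hp
    by_contra h'
    exact hp (if_neg h')
  refine ⟨?_, ⟨{p₀}, ?_, ?_⟩, ?_, ?_⟩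
  · intro p
    unfold vtx
    split <;> norm_num
  · intro p hp
    exact if_neg (by simpa using hp)
  · simp [vtx]
  · intro p hp
    rwa [hsupp p hp]
  · intro a ha b hb hab
    exact absurd ((hsupp a ha).trans (hsupp b hb).symm) hab

/-- Pushforward of weights along a map of vertex sets: the simplicial map induced on
realizations of order complexes. -/
def pushf {P Q : Type} (g : P → Q) (f : P → ℝ) : Q → ℝ :=
  fun q => ∑ᶠ p ∈ g ⁻¹' {q}, f p

/-! ### The fundamental group of an oriented graph -/

/-- The vertices of `G`, as a quiver. -/
abbrev QV (G : OrientedGraph) : Type := G.V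

instance (G : OrientedGraph) : Quiver (QV G) :=
  ⟨fun a b => {e : G.E // G.src e = a ∧ G.tgt e = b}⟩

/-- The class, in the free groupoid on the graph `G`, of a walk. -/
def walkHom (G : OrientedGraph) : (v : G.V) → (l : List (G.E × Bool)) → G.WalkFrom v l →
    ((Quiver.FreeGroupoid.of (QV G)).obj v ⟶ (Quiver.FreeGroupoid.of (QV G)).obj (G.walkEnd v l))
  | _, [], _ => 𝟙 _
  | v, (e, true) :: l, h =>
      eqToHom (congrArg (Quiver.FreeGroupoid.of (QV G)).obj h.1.symm) ≫
        ((Quiver.FreeGroupoid.of (QV G)).map (X := G.src e) (Y := G.tgt e) ⟨e, rfl, rfl⟩ ≫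
          walkHom G _ l h.2)
  | v, (e, false) :: l, h =>
      eqToHom (congrArg (Quiver.FreeGroupoid.of (QV G)).obj h.1.symm) ≫
        (Groupoid.inv ((Quiver.FreeGroupoid.of (QV G)).map (X := G.src e) (Y := G.tgt e) ⟨e, rfl, rfl⟩) ≫
          walkHom G _ l h.2)

/-- The class of a walk in the free groupoid on the graph. -/
def GWalk.toHom {G : OrientedGraph} (w : GWalk G) :
    ((Quiver.FreeGroupoid.of (QV G)).obj w.start ⟶ (Quiver.FreeGroupoid.of (QV G)).obj w.endV) :=
  walkHom G w.start w.steps w.valid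

/-- The fundamental group `π₁` of the graph `G` based at `v`: the vertex group of the free
groupoid on `G`. -/
abbrev Pi1 (G : OrientedGraph) (v : G.V) : Type :=
  ((Quiver.FreeGroupoid.of (QV G)).obj v ⟶ (Quiver.FreeGroupoid.of (QV G)).obj v)

/-- The class in `π₁(G, v₀)` of the loop `δ γ₁ γ₂⁻¹ δ⁻¹`, where `γ₁, γ₂` have common
endpoints and `δ` is a base path from `v₀`. -/
def loopClass {G : OrientedGraph} {v₀ : G.V} (δ γ₁ γ₂ : GWalk G)
    (hδs : δ.start = v₀) (hδe : δ.endV = γ₁.start)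
    (hs : γ₁.start = γ₂.start) (he : γ₁.endV = γ₂.endV) : Pi1 G v₀ :=
  eqToHom (congrArg (Quiver.FreeGroupoid.of (QV G)).obj hδs.symm) ≫ δ.toHom ≫
    eqToHom (congrArg (Quiver.FreeGroupoid.of (QV G)).obj hδe) ≫ γ₁.toHom ≫
    eqToHom (congrArg (Quiver.FreeGroupoid.of (QV G)).obj he) ≫ Groupoid.inv γ₂.toHom ≫
    eqToHom (congrArg (Quiver.FreeGroupoid.of (QV G)).obj (hs.symm.trans hδe.symm)) ≫
    Groupoid.inv δ.toHom ≫ eqToHom (congrArg (Quiver.FreeGroupoid.of (QV G)).obj hδs)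

/-- The set of classes of loops `γ₁ γ₂⁻¹` with `ρ(γ₁) ∼ ρ(γ₂)`, transported to the base
vertex `v₀` via the fixed base paths `δ`. -/
def SigmaSet {Θ Γ : OrientedGraph} (ρ : GraphMor Θ Γ) (SΓ : OrientedSystem Γ)
    (v₀ : Θ.V) (δ : Θ.V → GWalk Θ) : Set (Pi1 Θ v₀) :=
  {g | ∃ (γ₁ γ₂ : GWalk Θ) (hδs : (δ γ₁.start).start = v₀)
      (hδe : (δ γ₁.start).endV = γ₁.start)
      (hs : γ₁.start = γ₂.start) (he : γ₁.endV = γ₂.endV),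
      SΓ.rel (ρ.mapWalk γ₁) (ρ.mapWalk γ₂) ∧
      g = loopClass (δ γ₁.start) γ₁ γ₂ hδs hδe hs he}


theorem hyp_fun {d : ℕ} {H : Set (Fin d → ℝ)} (hH : IsHyperplane H) :
    ∃ g : (Fin d → ℝ) → ℝ, Continuous g ∧ (∀ z, z ∈ H ↔ g z = 0) ∧
      (∀ x y : Fin d → ℝ, ∀ t : ℝ, g (x + t • (y - x)) = (1 - t) * g x + t * g y) := by
  obtain ⟨a, b, -, rfl⟩ := hH
  refine ⟨fun x => ∑ i, a i * x i - b, by fun_prop, fun z => by simp [sub_eq_zero], ?_⟩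
  intro x y t
  have : ∑ i, a i * (x + t • (y - x)) i
      = (1 - t) * ∑ i, a i * x i + t * ∑ i, a i * y i := by
    rw [Finset.mul_sum, Finset.mul_sum, ← Finset.sum_add_distrib]
    refine Finset.sum_congr rfl fun i _ => ?_
    simp only [Pi.add_apply, Pi.smul_apply, Pi.sub_apply, smul_eq_mul]
    ring
  simp only [this]
  ring

theorem sameSide_iff {d : ℕ} {H : Set (Fin d → ℝ)} {g : (Fin d → ℝ) → ℝ}
    (hc : Continuous g) (h0 : ∀ z, z ∈ H ↔ g z = 0)
    (ha : ∀ x y : Fin d → ℝ, ∀ t : ℝ, g (x + t • (y - x)) = (1 - t) * g x + t * g y)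
    {x y : Fin d → ℝ} (hx : x ∉ H) (hy : y ∉ H) :
    SameSide H x y ↔ 0 < g x * g y := by
  have hx0 : g x ≠ 0 := fun h => hx ((h0 x).2 h)
  have hy0 : g y ≠ 0 := fun h => hy ((h0 y).2 h)
  constructor
  · intro hs
    by_contra hneg
    have hneg' : g x * g y < 0 := lt_of_le_of_ne (not_lt.1 hneg) (mul_ne_zero hx0 hy0)
    have hxm : x ∈ connectedComponentIn Hᶜ x := mem_connectedComponentIn hx
    have hym : y ∈ connectedComponentIn Hᶜ x := by
      unfold SameSide at hs
      rw [hs]; exact mem_connectedComponentIn hy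
    have hpre : (g '' connectedComponentIn Hᶜ x).OrdConnected :=
      (isPreconnected_connectedComponentIn.image g hc.continuousOn).ordConnected
    have hz : (0 : ℝ) ∈ g '' connectedComponentIn Hᶜ x := by
      rcases mul_neg_iff.1 hneg' with ⟨h1, h2⟩ | ⟨h1, h2⟩
      · exact hpre.out ⟨y, hym, rfl⟩ ⟨x, hxm, rfl⟩ ⟨h2.le, h1.le⟩
      · exact hpre.out ⟨x, hxm, rfl⟩ ⟨y, hym, rfl⟩ ⟨h1.le, h2.le⟩
    obtain ⟨z, hz, hz0⟩ := hz
    exact connectedComponentIn_subset _ _ hz ((h0 z).2 hz0)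
  · intro hpos
    have hsub : segment ℝ x y ⊆ Hᶜ := by
      intro z hz hzH
      rw [segment_eq_image'] at hz
      obtain ⟨t, ⟨ht0, ht1⟩, rfl⟩ := hz
      have h := (h0 _).1 hzH
      rw [ha] at h
      have h1 : (1 - t) * (g x * g x) + t * (g x * g y) = 0 := by linear_combination g x * h
      have h2 : 0 < g x * g x := mul_self_pos.2 hx0
      rcases ht0.eq_or_lt with rfl | ht
      · linarith
      · nlinarith [mul_pos ht hpos, mul_nonneg (sub_nonneg.2 ht1) h2.le]
    have hy' : y ∈ connectedComponentIn Hᶜ x :=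
      (convex_segment x y).isPreconnected.subset_connectedComponentIn
        (left_mem_segment ℝ x y) hsub (right_mem_segment ℝ x y)
    exact connectedComponentIn_eq hy'

theorem face_cond_iff {d : ℕ} {H : Set (Fin d → ℝ)} {g : (Fin d → ℝ) → ℝ}
    (hc : Continuous g) (h0 : ∀ z, z ∈ H ↔ g z = 0)
    (ha : ∀ x y : Fin d → ℝ, ∀ t : ℝ, g (x + t • (y - x)) = (1 - t) * g x + t * g y)
    (x y : Fin d → ℝ) :
    ((x ∈ H ↔ y ∈ H) ∧ (x ∉ H → SameSide H x y)) ↔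
      SignType.sign (g y) = SignType.sign (g x) := by
  by_cases hx : x ∈ H
  · have := (h0 x).1 hx
    simp [hx, h0 y, this, sign_eq_zero_iff]
  by_cases hy : y ∈ H
  · have := (h0 y).1 hy
    have hx0 : g x ≠ 0 := fun h => hx ((h0 x).2 h)
    simp only [hx, hy, this, sign_zero, eq_comm (a := (0 : SignType)), sign_eq_zero_iff, hx0]
    simp
  simp only [hx, hy, sameSide_iff hc h0 ha hx hy]
  have hx0 : g x ≠ 0 := fun h => hx ((h0 x).2 h)
  have hy0 : g y ≠ 0 := fun h => hy ((h0 y).2 h)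
  rcases hx0.lt_or_gt with h1 | h1 <;> rcases hy0.lt_or_gt with h2 | h2 <;>
    simp [sign_neg, sign_pos, h1, h2, mul_pos_iff, h1.le, h2.le, not_lt.2]

open Filter Topology in
theorem sign_seg_eventually (a b : ℝ) : ∀ᶠ t : ℝ in 𝓝[>] 0,
    SignType.sign ((1 - t) * a + t * b) =
      if SignType.sign a = 0 then SignType.sign b else SignType.sign a := by
  have hcont : Tendsto (fun t : ℝ => (1 - t) * a + t * b) (𝓝[>] 0) (𝓝 a) := by
    have : Continuous (fun t : ℝ => (1 - t) * a + t * b) := by fun_prop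
    have h := (this.tendsto 0).mono_left (nhdsWithin_le_nhds (s := Set.Ioi 0))
    simpa using h
  rcases lt_trichotomy a 0 with h | h | h
  · filter_upwards [hcont.eventually (gt_mem_nhds h)] with t ht
    simp [sign_neg, h, ht]
  · subst h
    filter_upwards [self_mem_nhdsWithin] with t ht
    have ht' : (0 : ℝ) < t := ht
    simp [sign_mul, sign_pos ht']
  · filter_upwards [hcont.eventually (lt_mem_nhds h)] with t ht
    simp [sign_pos, h, ht]

/-- For faces `F, P` of a finite affine hyperplane arrangement `𝒜` in `ℝ^d`
there is a unique face `Q` such that for every `x ∈ F` and `y ∈ P` there is `ε₀ > 0` with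
`x + ε (y - x) ∈ Q` for all `0 < ε < ε₀` (the composition `F ∘ P`). -/
theorem statement_0 {d : ℕ} (𝒜 : Finset (Set (Fin d → ℝ))) (h𝒜 : IsArrangement 𝒜)
    (F P : Set (Fin d → ℝ)) (hF : F ∈ Faces 𝒜) (hP : P ∈ Faces 𝒜) :
    ∃! Q, Q ∈ Faces 𝒜 ∧ CompProp F P Q := by
  have hg : ∀ H : Set (Fin d → ℝ), ∃ g : (Fin d → ℝ) → ℝ, H ∈ 𝒜 →
      Continuous g ∧ (∀ z, z ∈ H ↔ g z = 0) ∧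
      (∀ x y : Fin d → ℝ, ∀ t : ℝ, g (x + t • (y - x)) = (1 - t) * g x + t * g y) := by
    intro H
    by_cases hH : H ∈ 𝒜
    · obtain ⟨g, hg⟩ := hyp_fun (h𝒜 H hH)
      exact ⟨g, fun _ => hg⟩
    · exact ⟨0, fun h => absurd h hH⟩
  choose g hg using hg
  have hface : ∀ x y, y ∈ faceOf 𝒜 x ↔
      ∀ H ∈ 𝒜, SignType.sign (g H y) = SignType.sign (g H x) := by
    intro x y
    refine forall₂_congr fun H hH => ?_
    obtain ⟨hc, h0, ha⟩ := hg H hH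
    exact face_cond_iff hc h0 ha x y
  have hself : ∀ x, x ∈ faceOf 𝒜 x := fun x => (hface x x).2 fun _ _ => rfl
  have heq : ∀ x w, w ∈ faceOf 𝒜 x → faceOf 𝒜 x = faceOf 𝒜 w := by
    intro x w hw
    rw [hface] at hw
    ext y
    rw [hface, hface]
    exact forall₂_congr fun H hH => by rw [hw H hH]
  have hev : ∀ x y : Fin d → ℝ, ∀ᶠ t : ℝ in nhdsWithin 0 (Set.Ioi 0), ∀ H ∈ 𝒜,
      SignType.sign (g H (x + t • (y - x))) =
        if SignType.sign (g H x) = 0 then SignType.sign (g H y)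
          else SignType.sign (g H x) := by
    intro x y
    rw [Filter.eventually_all_finset]
    intro H hH
    filter_upwards [sign_seg_eventually (g H x) (g H y)] with t ht
    rw [(hg H hH).2.2, ht]
  obtain ⟨x₀, rfl⟩ := hF
  obtain ⟨y₀, rfl⟩ := hP
  obtain ⟨t₀, ht₀⟩ := (hev x₀ y₀).exists
  refine ⟨faceOf 𝒜 (x₀ + t₀ • (y₀ - x₀)), ⟨⟨_, rfl⟩, ?_⟩, ?_⟩
  · intro x hx y hy
    rw [hface] at hx hy
    have h := hev x y
    rw [Filter.Eventually, mem_nhdsGT_iff_exists_Ioo_subset] at h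
    obtain ⟨e, he, hsub⟩ := h
    refine ⟨e, he, fun ε h0 h1 => ?_⟩
    rw [hface]
    intro H hH
    have h2 := hsub ⟨h0, h1⟩ H hH
    rw [h2, ht₀ H hH, hx H hH, hy H hH]
  · rintro Q ⟨⟨z, rfl⟩, hQ⟩
    obtain ⟨e, he, hQ⟩ := hQ x₀ (hself _) y₀ (hself _)
    have h := hev x₀ y₀
    have hlt : ∀ᶠ t : ℝ in nhdsWithin 0 (Set.Ioi 0), t ∈ Set.Ioo 0 e := Ioo_mem_nhdsGT he
    obtain ⟨t, h1, h2⟩ := (h.and hlt).exists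
    rw [heq _ _ (hQ t h2.1 h2.2)]
    refine (heq _ _ ?_).symm
    rw [hface]
    intro H hH
    rw [h1 H hH, ht₀ H hH]

end
end

section
/- Let 𝒜 be a finite affine hyperplane arrangement in ℝ^d. The order complex Δ(Plim 𝒟_id) coincides with the Salvetti complex Sal(𝒜) as abstract simplicial complexes: both have vertex set {(F,C) : F ∈ 𝓕(𝒜), C ∈ 𝒞(𝒜), F > C}, and a finite set of such pairs is a chain of Plim 𝒟_id if and only if it is a simplex of Sal(𝒜). -/
open CategoryTheory

attribute [local instance] Classical.propDecidable

noncomputable section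

/-- A simplex of the Salvetti complex: a finite set of pairs `(F, C)` which can be
enumerated as `(F₀,C₀), …, (F_k,C_k)` with `F₀ > F₁ > ⋯ > F_k` and
`(C₀)_{F_i} = (C_i)_{F_i}` for all `i`. -/
def SalSimplex {d : ℕ} (𝒜 : Finset (Set (Fin d → ℝ)))
    (s : Finset (Set (Fin d → ℝ) × Set (Fin d → ℝ))) : Prop :=
  ∃ l : List (Set (Fin d → ℝ) × Set (Fin d → ℝ)), l.Nodup ∧ l.toFinset = s ∧
    l.Chain' (fun p q => FaceGT p.1 q.1) ∧
    ∀ hd, l.head? = some hd → ∀ p ∈ l, faceComp 𝒜 p.1 hd.2 = faceComp 𝒜 p.1 p.2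

/-- Affine-type functions used to describe hyperplanes. -/
def S8Good {d : ℕ} (f : (Fin d → ℝ) → ℝ) : Prop :=
  Continuous f ∧ ∀ x y (ε : ℝ), f (x + ε • (y - x)) = f x + ε * (f y - f x)

/-- Family of defining functions. -/
def S8Def {d : ℕ} (𝒜 : Finset (Set (Fin d → ℝ)))
    (f : Set (Fin d → ℝ) → (Fin d → ℝ) → ℝ) : Prop :=
  ∀ H ∈ 𝒜, S8Good (f H) ∧ ∀ x, x ∈ H ↔ f H x = 0

theorem s8_exists {d : ℕ} {𝒜 : Finset (Set (Fin d → ℝ))} (h𝒜 : IsArrangement 𝒜) :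
    ∃ f, S8Def 𝒜 f := by
  have h : ∀ H : Set (Fin d → ℝ), ∃ g : (Fin d → ℝ) → ℝ, H ∈ 𝒜 →
      (S8Good g ∧ ∀ x, x ∈ H ↔ g x = 0) := by
    intro H
    by_cases hH : H ∈ 𝒜
    · obtain ⟨a, b, -, rfl⟩ := h𝒜 H hH
      refine ⟨fun x => ∑ i, a i * x i - b, fun _ => ⟨⟨by fun_prop, ?_⟩, ?_⟩⟩
      · intro x y ε
        have : ∑ i, a i * (x + ε • (y - x)) i
            = ∑ i, a i * x i + ε * (∑ i, a i * y i - ∑ i, a i * x i) := by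
          rw [← Finset.sum_sub_distrib, Finset.mul_sum, ← Finset.sum_add_distrib]
          refine Finset.sum_congr rfl fun i _ => ?_
          simp only [Pi.add_apply, Pi.smul_apply, Pi.sub_apply, smul_eq_mul]
          ring
        simp only [this]
        ring
      · intro x
        simp [sub_eq_zero]
    · exact ⟨fun _ => 0, fun h => absurd h hH⟩
  choose f hf using h
  exact ⟨f, fun H hH => hf H hH⟩

theorem s8_convex {d : ℕ} {f : (Fin d → ℝ) → ℝ} (hf : S8Good f) (c : SignType) :
    Convex ℝ {y | SignType.sign (f y) = c} := by
  intro u hu v hv a b ha hb hab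
  have e : a • u + b • v = u + b • (v - u) := by
    have : a = 1 - b := by linarith
    subst this
    module
  simp only [Set.mem_setOf_eq] at hu hv ⊢
  rw [e, hf.2]
  have e2 : f u + b * (f v - f u) = a * f u + b * f v := by
    have : a = 1 - b := by linarith
    subst this
    ring
  rw [e2]
  have hpos : 0 < a ∨ 0 < b := by
    rcases lt_or_eq_of_le ha with h | h
    · exact Or.inl h
    · right; linarith
  rcases lt_trichotomy (f u) 0 with h | h | h
  · rw [sign_neg h] at hu
    subst hu
    rw [sign_eq_neg_one_iff] at hv ⊢
    rcases hpos with h' | h'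
    · nlinarith [mul_pos h' (neg_pos.2 h), mul_nonneg hb (neg_pos.2 hv).le]
    · nlinarith [mul_nonneg ha (neg_pos.2 h).le, mul_pos h' (neg_pos.2 hv)]
  · rw [h, sign_zero] at hu
    subst hu
    rw [sign_eq_zero_iff] at hv ⊢
    simp [h, hv]
  · rw [sign_pos h] at hu
    subst hu
    rw [sign_eq_one_iff] at hv ⊢
    rcases hpos with h' | h'
    · nlinarith [mul_pos h' h, mul_nonneg hb hv.le]
    · nlinarith [mul_nonneg ha h.le, mul_pos h' hv]

theorem s8_sign_of_preconn {d : ℕ} {f : (Fin d → ℝ) → ℝ} (hf : S8Good f)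
    {S : Set (Fin d → ℝ)} (hS : _root_.IsPreconnected S) (h0 : ∀ z ∈ S, f z ≠ 0)
    {x y : Fin d → ℝ} (hx : x ∈ S) (hy : y ∈ S) :
    SignType.sign (f y) = SignType.sign (f x) := by
  rcases lt_or_gt_of_ne (h0 x hx) with h | h <;> rcases lt_or_gt_of_ne (h0 y hy) with h' | h'
  · rw [sign_neg h, sign_neg h']
  · obtain ⟨z, hz, hz0⟩ := hS.intermediate_value hx hy hf.1.continuousOn ⟨h.le, h'.le⟩
    exact absurd hz0 (h0 z hz)
  · obtain ⟨z, hz, hz0⟩ := hS.intermediate_value hy hx hf.1.continuousOn ⟨h'.le, h.le⟩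
    exact absurd hz0 (h0 z hz)
  · rw [sign_pos h, sign_pos h']

theorem s8_sameSide {d : ℕ} {H : Set (Fin d → ℝ)} {f : (Fin d → ℝ) → ℝ}
    (hf : S8Good f) (hH : ∀ x, x ∈ H ↔ f x = 0) {x y : Fin d → ℝ} (hx : x ∉ H) (hy : y ∉ H) :
    SameSide H x y ↔ SignType.sign (f y) = SignType.sign (f x) := by
  constructor
  · intro h
    refine s8_sign_of_preconn hf (isPreconnected_connectedComponentIn (F := Hᶜ) (x := x))
      (fun z hz h0 => connectedComponentIn_subset _ _ hz ((hH z).2 h0))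
      (mem_connectedComponentIn hx) ?_
    rw [show connectedComponentIn Hᶜ x = connectedComponentIn Hᶜ y from h]
    exact mem_connectedComponentIn hy
  · intro h
    refine connectedComponentIn_eq
      ((s8_convex hf (SignType.sign (f x))).isPreconnected.subset_connectedComponentIn
        (F := Hᶜ) rfl ?_ h)
    intro z hz hzH
    have hz' : SignType.sign (f z) = SignType.sign (f x) := hz
    rw [(hH z).1 hzH, sign_zero, eq_comm, sign_eq_zero_iff] at hz'
    exact hx ((hH x).2 hz')

theorem s8_mem_face {d : ℕ} {𝒜 : Finset (Set (Fin d → ℝ))} {f} (hf : S8Def 𝒜 f)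
    (x y : Fin d → ℝ) :
    y ∈ faceOf 𝒜 x ↔ ∀ H ∈ 𝒜, SignType.sign (f H y) = SignType.sign (f H x) := by
  refine forall₂_congr fun H hH => ?_
  obtain ⟨hg, hz⟩ := hf H hH
  by_cases hx : x ∈ H
  · have : f H x = 0 := (hz x).1 hx
    simp [hx, hz y, this, sign_eq_zero_iff]
  · by_cases hy : y ∈ H
    · have h1 : f H y = 0 := (hz y).1 hy
      have h2 : f H x ≠ 0 := fun h => hx ((hz x).2 h)
      simp only [hx, hy, h1, sign_zero, iff_true, false_and, false_iff]
      intro h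
      exact h2 (sign_eq_zero_iff.1 h.symm)
    · simp [hx, hy, s8_sameSide hg hz hx hy]

theorem s8_face_eq {d : ℕ} {𝒜 : Finset (Set (Fin d → ℝ))} {f} (hf : S8Def 𝒜 f)
    {x y : Fin d → ℝ} (h : ∀ H ∈ 𝒜, SignType.sign (f H y) = SignType.sign (f H x)) :
    faceOf 𝒜 y = faceOf 𝒜 x := by
  ext z
  rw [s8_mem_face hf, s8_mem_face hf]
  exact forall₂_congr fun H hH => by rw [h H hH]

theorem s8_chamber {d : ℕ} {𝒜 : Finset (Set (Fin d → ℝ))} {f} (hf : S8Def 𝒜 f)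
    {C : Set (Fin d → ℝ)} (hC : IsChamber 𝒜 C) : C ∈ Faces 𝒜 := by
  obtain ⟨x, hx, rfl⟩ := hC
  refine ⟨x, Set.Subset.antisymm ?_ ?_⟩
  · intro y hy
    rw [s8_mem_face hf]
    intro H hH
    refine s8_sign_of_preconn (hf H hH).1
      (isPreconnected_connectedComponentIn (F := (ArrUnion 𝒜)ᶜ) (x := x))
      ?_ (mem_connectedComponentIn hx) hy
    intro z hz h0
    exact connectedComponentIn_subset _ _ hz
      (Set.mem_biUnion (t := fun H => H) hH (((hf H hH).2 z).2 h0))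
  · have hc : Convex ℝ (faceOf 𝒜 x) := by
      have : faceOf 𝒜 x = ⋂ H ∈ 𝒜, {y | SignType.sign (f H y) = SignType.sign (f H x)} := by
        ext y
        simp [s8_mem_face hf]
      rw [this]
      exact convex_iInter₂ fun H hH => s8_convex (hf H hH).1 _
    refine hc.isPreconnected.subset_connectedComponentIn ((s8_mem_face hf x x).2 fun _ _ => rfl) ?_
    intro z hz hzA
    simp only [ArrUnion, Set.mem_iUnion] at hzA
    obtain ⟨H, hH, hzH⟩ := hzA
    exact hx (Set.mem_biUnion (t := fun H => H) hH (((hz H hH).1).2 hzH))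

theorem s8_ge {d : ℕ} {𝒜 : Finset (Set (Fin d → ℝ))} {f} (hf : S8Def 𝒜 f)
    {x y : Fin d → ℝ} (h : FaceGE (faceOf 𝒜 x) (faceOf 𝒜 y)) :
    ∀ H ∈ 𝒜, SignType.sign (f H x) = 0 ∨ SignType.sign (f H x) = SignType.sign (f H y) := by
  intro H hH
  have hx : x ∈ closure (faceOf 𝒜 y) :=
    h (subset_closure ((s8_mem_face hf x x).2 fun _ _ => rfl))
  have hc := (hf H hH).1.1
  have key : ∀ z ∈ faceOf 𝒜 y, SignType.sign (f H z) = SignType.sign (f H y) :=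
    fun z hz => (s8_mem_face hf y z).1 hz H hH
  rcases lt_trichotomy (f H y) 0 with hy | hy | hy
  · have : f H x ≤ 0 := by
      refine closure_minimal (t := {z | f H z ≤ 0}) ?_ (isClosed_le hc continuous_const) hx
      intro z hz
      have := key z hz
      rw [sign_neg hy, sign_eq_neg_one_iff] at this
      exact this.le
    rcases lt_or_eq_of_le this with h | h
    · right; rw [sign_neg hy, sign_neg h]
    · left; rw [h, sign_zero]
  · left
    rw [sign_eq_zero_iff]
    refine closure_minimal (t := {z | f H z = 0}) ?_ (isClosed_eq hc continuous_const) hx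
    intro z hz
    have := key z hz
    rwa [hy, sign_zero, sign_eq_zero_iff] at this
  · have : 0 ≤ f H x := by
      refine closure_minimal (t := {z | 0 ≤ f H z}) ?_ (isClosed_le continuous_const hc) hx
      intro z hz
      have := key z hz
      rw [sign_pos hy, sign_eq_one_iff] at this
      exact this.le
    rcases lt_or_eq_of_le this with h | h
    · right; rw [sign_pos hy, sign_pos h]
    · left; rw [← h, sign_zero]

/-- Composition of signs. -/
def s8c (a b : SignType) : SignType := if a = 0 then b else a

open Topology in
theorem s8_small {d : ℕ} {𝒜 : Finset (Set (Fin d → ℝ))} {f} (hf : S8Def 𝒜 f)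
    (x y : Fin d → ℝ) :
    ∃ ε₀ > (0 : ℝ), ∀ ε : ℝ, 0 < ε → ε < ε₀ → ∀ H ∈ 𝒜,
      SignType.sign (f H (x + ε • (y - x)))
        = s8c (SignType.sign (f H x)) (SignType.sign (f H y)) := by
  have hev : ∀ᶠ ε in 𝓝[>] (0 : ℝ), ∀ H ∈ 𝒜, SignType.sign (f H (x + ε • (y - x)))
        = s8c (SignType.sign (f H x)) (SignType.sign (f H y)) := by
    rw [Filter.eventually_all_finset]
    intro H hH
    have hc : Filter.Tendsto (fun ε : ℝ => f H x + ε * (f H y - f H x)) (𝓝[>] 0) (𝓝 (f H x)) := by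
      have : Continuous (fun ε : ℝ => f H x + ε * (f H y - f H x)) := by fun_prop
      have := this.tendsto 0
      simp only [zero_mul, add_zero] at this
      exact this.mono_left nhdsWithin_le_nhds
    rcases lt_trichotomy (f H x) 0 with h | h | h
    · filter_upwards [hc.eventually_lt_const h] with ε hε
      rw [(hf H hH).1.2, sign_neg hε, sign_neg h]
      simp [s8c]
    · filter_upwards [self_mem_nhdsWithin] with ε hε
      have hε : 0 < ε := hε
      rw [(hf H hH).1.2, h, sign_zero]
      simp [s8c, sign_mul, sign_pos hε]
    · filter_upwards [hc.eventually_const_lt h] with ε hε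
      rw [(hf H hH).1.2, sign_pos hε, sign_pos h]
      simp [s8c]
  obtain ⟨u, hu, hsub⟩ := mem_nhdsGT_iff_exists_Ioo_subset.1 hev
  exact ⟨u, hu, fun ε h1 h2 => hsub ⟨h1, h2⟩⟩

theorem s8_comp {d : ℕ} {𝒜 : Finset (Set (Fin d → ℝ))} {f} (hf : S8Def 𝒜 f)
    (x y : Fin d → ℝ) :
    ∃ z, faceComp 𝒜 (faceOf 𝒜 x) (faceOf 𝒜 y) = faceOf 𝒜 z ∧
      ∀ H ∈ 𝒜, SignType.sign (f H z) = s8c (SignType.sign (f H x)) (SignType.sign (f H y)) := by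
  obtain ⟨ε₀, h0, hε⟩ := s8_small hf x y
  have hz := hε (ε₀ / 2) (by linarith) (by linarith)
  set z := x + (ε₀ / 2) • (y - x) with hzdef
  have hx : x ∈ faceOf 𝒜 x := (s8_mem_face hf x x).2 fun _ _ => rfl
  have hy : y ∈ faceOf 𝒜 y := (s8_mem_face hf y y).2 fun _ _ => rfl
  have hU : ∃! Q, Q ∈ Faces 𝒜 ∧ CompProp (faceOf 𝒜 x) (faceOf 𝒜 y) Q := by
    refine ⟨faceOf 𝒜 z, ⟨⟨z, rfl⟩, ?_⟩, ?_⟩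
    · intro x' hx' y' hy'
      obtain ⟨ε₁, h1, hε₁⟩ := s8_small hf x' y'
      refine ⟨ε₁, h1, fun ε ha hb => ?_⟩
      rw [s8_mem_face hf] at hx' hy' ⊢
      intro H hH
      rw [hε₁ ε ha hb H hH, hz H hH, hx' H hH, hy' H hH]
    · rintro Q ⟨⟨w, rfl⟩, hQ⟩
      obtain ⟨ε₁, h1, hε₁⟩ := hQ x hx y hy
      have hm : 0 < min ε₀ ε₁ := lt_min h0 h1
      have hm1 := min_le_left ε₀ ε₁
      have hm2 := min_le_right ε₀ ε₁
      have hw := hε₁ (min ε₀ ε₁ / 2) (by linarith) (by linarith)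
      have hz' := hε (min ε₀ ε₁ / 2) (by linarith) (by linarith)
      rw [s8_mem_face hf] at hw
      refine s8_face_eq hf fun H hH => ?_
      rw [hz H hH, ← hz' H hH, hw H hH]
  refine ⟨z, ?_, hz⟩
  unfold faceComp
  rw [dif_pos hU]
  refine hU.unique hU.choose_spec.1 ⟨⟨z, rfl⟩, ?_⟩
  intro x' hx' y' hy'
  obtain ⟨ε₁, h1, hε₁⟩ := s8_small hf x' y'
  refine ⟨ε₁, h1, fun ε ha hb => ?_⟩
  rw [s8_mem_face hf] at hx' hy' ⊢
  intro H hH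
  rw [hε₁ ε ha hb H hH, hz H hH, hx' H hH, hy' H hH]

theorem s8_antisymm {d : ℕ} {𝒜 : Finset (Set (Fin d → ℝ))} (h𝒜 : IsArrangement 𝒜)
    {F G : Set (Fin d → ℝ)} (hF : F ∈ Faces 𝒜) (hG : G ∈ Faces 𝒜)
    (h1 : FaceGE F G) (h2 : FaceGE G F) : F = G := by
  obtain ⟨f, hf⟩ := s8_exists h𝒜
  obtain ⟨x, rfl⟩ := hF
  obtain ⟨y, rfl⟩ := hG
  refine s8_face_eq hf fun H hH => ?_
  have a := s8_ge hf h1 H hH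
  have b := s8_ge hf h2 H hH
  rcases a with a | a
  · rcases b with b | b
    · rw [a, b]
    · exact b.symm
  · exact a

theorem s8_comp_self {d : ℕ} {𝒜 : Finset (Set (Fin d → ℝ))} (h𝒜 : IsArrangement 𝒜)
    {F C : Set (Fin d → ℝ)} (hF : F ∈ Faces 𝒜) (hC : C ∈ Faces 𝒜)
    (h : FaceGE F C) : faceComp 𝒜 F C = C := by
  obtain ⟨f, hf⟩ := s8_exists h𝒜
  obtain ⟨x, rfl⟩ := hF
  obtain ⟨y, rfl⟩ := hC
  obtain ⟨z, e, hz⟩ := s8_comp hf x y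
  rw [e]
  refine s8_face_eq hf fun H hH => ?_
  rw [hz H hH, s8c]
  have a := s8_ge hf h H hH
  split_ifs with h0
  · rfl
  · exact a.resolve_left h0

theorem s8_comp_comp {d : ℕ} {𝒜 : Finset (Set (Fin d → ℝ))} (h𝒜 : IsArrangement 𝒜)
    {F G C : Set (Fin d → ℝ)} (hF : F ∈ Faces 𝒜) (hG : G ∈ Faces 𝒜) (hC : C ∈ Faces 𝒜)
    (h : FaceGE F G) : faceComp 𝒜 G (faceComp 𝒜 F C) = faceComp 𝒜 G C := by
  obtain ⟨f, hf⟩ := s8_exists h𝒜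
  obtain ⟨x, rfl⟩ := hF
  obtain ⟨g, rfl⟩ := hG
  obtain ⟨y, rfl⟩ := hC
  obtain ⟨z, e, hz⟩ := s8_comp hf x y
  obtain ⟨w, e', hw⟩ := s8_comp hf g y
  rw [e, e']
  obtain ⟨v, e'', hv⟩ := s8_comp hf g z
  rw [e'']
  refine s8_face_eq hf fun H hH => ?_
  rw [hv H hH, hw H hH, hz H hH]
  have a := s8_ge hf h H hH
  unfold s8c
  split_ifs with h0 h1
  · rfl
  · exact absurd (a.resolve_left h1) (by rw [h0]; exact h1)
  · rfl

theorem s8_face2 {d : ℕ} {𝒜 : Finset (Set (Fin d → ℝ))} (h𝒜 : IsArrangement 𝒜)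
    {p : Set (Fin d → ℝ) × Set (Fin d → ℝ)} (h : PlimIdMem 𝒜 p) : p.2 ∈ Faces 𝒜 := by
  obtain ⟨f, hf⟩ := s8_exists h𝒜
  exact s8_chamber hf h.2.1

theorem s8_sort {d : ℕ} (𝒜 : Finset (Set (Fin d → ℝ))) (h𝒜 : IsArrangement 𝒜) :
    ∀ s : Finset (Set (Fin d → ℝ) × Set (Fin d → ℝ)), (∀ p ∈ s, PlimIdMem 𝒜 p) →
    IsChain (PlimIdGE 𝒜) (s : Set (Set (Fin d → ℝ) × Set (Fin d → ℝ))) →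
    ∃ l : List (Set (Fin d → ℝ) × Set (Fin d → ℝ)), l.Nodup ∧ l.toFinset = s ∧
      l.Pairwise (fun p q => PlimIdGE 𝒜 p q ∧ p.1 ≠ q.1) := by
  intro s
  induction s using Finset.strongInduction with
  | H s ih =>
    intro hv hs
    rcases s.eq_empty_or_nonempty with rfl | hne
    · exact ⟨[], by simp⟩
    obtain ⟨m, hm, hmin⟩ := Finset.exists_minimalFor (fun p => closure p.1) s hne
    obtain ⟨l, h1, h2, h3⟩ := ih (s.erase m) (Finset.erase_ssubset hm)
      (fun p hp => hv p (Finset.mem_of_mem_erase hp))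
      (hs.mono (by simp))
    have hml : m ∉ l := by
      rw [← List.mem_toFinset, h2]; simp
    refine ⟨m :: l, List.nodup_cons.2 ⟨hml, h1⟩, ?_, List.pairwise_cons.2 ⟨?_, h3⟩⟩
    · rw [List.toFinset_cons, h2, Finset.insert_erase hm]
    · intro q hq
      rw [← List.mem_toFinset, h2, Finset.mem_erase] at hq
      have hne1 : m.1 ≠ q.1 := by
        intro e
        rcases hs hm hq.2 hq.1.symm with h | h
        · rcases h.2 with h | h
          · exact hq.1 (Prod.ext h.1.symm h.2.symm)
          · exact h.1 e
        · rcases h.2 with h | h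
          · exact hq.1 (Prod.ext h.1 h.2)
          · exact h.1 e.symm
      refine ⟨?_, hne1⟩
      rcases hs hm hq.2 hq.1.symm with h | h
      · exact h
      · exact absurd (s8_antisymm h𝒜 (hv m hm).1 (hv q hq.2).1 (hmin hq.2 h.1) h.1) hne1

theorem s8_pairwise {d : ℕ} (𝒜 : Finset (Set (Fin d → ℝ))) (h𝒜 : IsArrangement 𝒜) :
    ∀ l : List (Set (Fin d → ℝ) × Set (Fin d → ℝ)), (∀ p ∈ l, PlimIdMem 𝒜 p) →
    l.IsChain (fun p q => FaceGT p.1 q.1) → l.Pairwise (fun p q => FaceGT p.1 q.1)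
  | [], _, _ => List.Pairwise.nil
  | [a], _, _ => List.pairwise_singleton _ _
  | a :: b :: l, hv, hc => by
      rw [List.isChain_cons_cons] at hc
      have ih := s8_pairwise 𝒜 h𝒜 (b :: l) (fun p hp => hv p (List.mem_cons_of_mem _ hp)) hc.2
      refine List.pairwise_cons.2 ⟨?_, ih⟩
      intro q hq
      rcases List.mem_cons.1 hq with rfl | hq'
      · exact hc.1
      have hbq := (List.pairwise_cons.1 ih).1 q hq'
      refine ⟨hc.1.1.trans hbq.1, fun e => ?_⟩
      refine hbq.2 (s8_antisymm h𝒜 (hv b (by simp)).1 (hv q (by simp [hq'])).1 hbq.1 ?_)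
      rw [← e]
      exact hc.1.1

/-- The order complex of `Plim 𝒟_id` coincides with the Salvetti complex:
a finite set of pairs `(F, C)` with `F > C` is a chain of `Plim 𝒟_id` if and only if it is a
simplex of `Sal(𝒜)`. -/
theorem statement_8 {d : ℕ} (𝒜 : Finset (Set (Fin d → ℝ))) (h𝒜 : IsArrangement 𝒜)
    (s : Finset (Set (Fin d → ℝ) × Set (Fin d → ℝ))) (hv : ∀ p ∈ s, PlimIdMem 𝒜 p) :
    IsChain (PlimIdGE 𝒜) ↑s ↔ SalSimplex 𝒜 s := by
  constructor
  · intro hs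
    obtain ⟨l, h1, h2, h3⟩ := s8_sort 𝒜 h𝒜 s hv hs
    refine ⟨l, h1, h2, (h3.imp fun h => ⟨h.1.1, h.2⟩).isChain, ?_⟩
    intro hd hhd p hp
    cases l with
    | nil => simp at hhd
    | cons a l =>
      simp only [List.head?_cons, Option.some.injEq] at hhd
      subst hhd
      rcases List.mem_cons.1 hp with rfl | hp'
      · rfl
      have hps : PlimIdMem 𝒜 p := hv p (by rw [← h2]; simpa using Or.inr hp')
      have h := (List.pairwise_cons.1 h3).1 p hp'
      rw [s8_comp_self h𝒜 hps.1 (s8_face2 h𝒜 hps) hps.2.2.1]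
      rcases h.1.2 with h' | h'
      · exact absurd h'.1 h.2
      · exact h'.2.symm
  · rintro ⟨l, -, h2, h3, h4⟩
    have hl : ∀ p ∈ l, PlimIdMem 𝒜 p := fun p hp => hv p (by rw [← h2]; simpa using hp)
    have hp := s8_pairwise 𝒜 h𝒜 l hl h3
    cases l with
    | nil =>
      subst h2
      simp
    | cons a l =>
      have h4' := h4 a rfl
      have key : ∀ p ∈ a :: l, ∀ q ∈ a :: l, FaceGT p.1 q.1 → PlimIdGE 𝒜 p q := by
        intro p hpl q hql h
        refine ⟨h.1, Or.inr ⟨h.2, ?_⟩⟩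
        have hP := hl p hpl
        have hQ := hl q hql
        have hA := s8_face2 h𝒜 (hl a (by simp))
        have e1 := s8_comp_self h𝒜 hP.1 (s8_face2 h𝒜 hP) hP.2.2.1
        have e2 := s8_comp_self h𝒜 hQ.1 (s8_face2 h𝒜 hQ) hQ.2.2.1
        rw [← e2, ← h4' q hql, ← s8_comp_comp h𝒜 hP.1 hQ.1 hA h.1, h4' p hpl, e1]
      have hp2 : (a :: l).Pairwise (fun p q => PlimIdGE 𝒜 p q ∨ PlimIdGE 𝒜 q p) :=
        hp.imp_of_mem fun hx hy h => Or.inl (key _ hx _ hy h)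
      intro p hps q hqs hne
      rw [← h2] at hps hqs
      haveI : Std.Symm (fun p q => PlimIdGE 𝒜 p q ∨ PlimIdGE 𝒜 q p) :=
        ⟨fun _ _ h => Or.symm h⟩
      exact hp2.forall (by simpa using hps) (by simpa using hqs) hne

end
end

section
/- Let 𝒜 be a finite affine hyperplane arrangement in ℝ^d and ρ : (Θ,∼_Θ) → (Γ(𝒜),∼) a cover of oriented systems. Let v₁ ≠ v₂ be vertices of Θ, let F ∈ 𝓕(𝒜) be a face of codimension 1 and v a vertex of Θ with F > ρ(v). Then (F,v) > (ρ(v₁),v₁) and (F,v) > (ρ(v₂),v₂) hold in Plim 𝒟_ρ if and only if F > ρ(v₁), F > ρ(v₂), and either v = v₁ and Θ has a directed edge from v₁ to v₂ projecting to the edge from ρ(v₁) to ρ(v₂), or v = v₂ and Θ has a directed edge from v₂ to v₁ projecting to the edge from ρ(v₂) to ρ(v₁). -/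
open CategoryTheory

attribute [local instance] Classical.propDecidable

noncomputable section

/-! ### Auxiliary lemmas -/

theorem hyp_lin {d : ℕ} {H : Set (Fin d → ℝ)} (h : IsHyperplane H) :
    ∃ (f : (Fin d → ℝ) →ₗ[ℝ] ℝ) (b : ℝ), f ≠ 0 ∧ H = {x | f x = b} := by
  obtain ⟨a, b, ha, rfl⟩ := h
  refine ⟨∑ i, a i • LinearMap.proj i, b, ?_, ?_⟩
  · intro h0
    apply ha
    funext i
    have := congrArg (fun g => g (Pi.single i 1)) h0
    simpa [Pi.single_apply] using this
  · ext x
    simp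

theorem lin_cont {d : ℕ} (f : (Fin d → ℝ) →ₗ[ℝ] ℝ) : Continuous f :=
  f.continuous_of_finiteDimensional

theorem side_seg {d : ℕ} {f : (Fin d → ℝ) →ₗ[ℝ] ℝ} {b : ℝ} {x y : Fin d → ℝ}
    (hx : f x ≠ b) (hy : f y ≠ b) (h : b < f x ↔ b < f y) :
    segment ℝ x y ⊆ {z | f z = b}ᶜ := by
  rcases lt_or_gt_of_ne hx with h1 | h1
  · have h2 : f y < b := lt_of_le_of_ne (not_lt.1 (fun h' => lt_asymm h1 (h.2 h'))) hy
    intro z hz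
    have := (convex_halfSpace_lt f.isLinear b).segment_subset h1 h2 hz
    exact ne_of_lt this
  · have h2 : b < f y := h.1 h1
    intro z hz
    have := (convex_halfSpace_gt f.isLinear b).segment_subset h1 h2 hz
    exact ne_of_gt this

theorem sameSide_iff_s12 {d : ℕ} {f : (Fin d → ℝ) →ₗ[ℝ] ℝ} {b : ℝ} {x y : Fin d → ℝ}
    (hx : f x ≠ b) (hy : f y ≠ b) :
    SameSide {z | f z = b} x y ↔ (b < f x ↔ b < f y) := by
  constructor
  · intro h
    have hxm := mem_connectedComponentIn (F := {z | f z = b}ᶜ) hx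
    have hym := mem_connectedComponentIn (F := {z | f z = b}ᶜ) hy
    unfold SameSide at h
    rw [← h] at hym
    have hp : _root_.IsPreconnected (connectedComponentIn {z | f z = b}ᶜ x) :=
      isPreconnected_connectedComponentIn
    constructor
    · intro h1
      by_contra h2
      obtain ⟨z, hz, hzb⟩ := hp.intermediate_value hym hxm (lin_cont f).continuousOn
        ⟨not_lt.1 h2, h1.le⟩
      exact connectedComponentIn_subset _ _ hz hzb
    · intro h1
      by_contra h2
      obtain ⟨z, hz, hzb⟩ := hp.intermediate_value hxm hym (lin_cont f).continuousOn
        ⟨not_lt.1 h2, h1.le⟩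
      exact connectedComponentIn_subset _ _ hz hzb
  · intro h
    apply connectedComponentIn_eq
    exact (convex_segment x y).isPreconnected.subset_connectedComponentIn
      (left_mem_segment ℝ x y) (side_seg hx hy h) (right_mem_segment ℝ x y)

theorem mem_faceOf_self {d : ℕ} (𝒜 : Finset (Set (Fin d → ℝ))) (x : Fin d → ℝ) :
    x ∈ faceOf 𝒜 x := fun _ _ => ⟨Iff.rfl, fun _ => rfl⟩

theorem faceOf_eq {d : ℕ} {𝒜 : Finset (Set (Fin d → ℝ))} {x y : Fin d → ℝ}
    (h : y ∈ faceOf 𝒜 x) : faceOf 𝒜 x = faceOf 𝒜 y := by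
  ext z
  constructor
  · intro hz H hH
    refine ⟨(h H hH).1.symm.trans (hz H hH).1, fun hy => ?_⟩
    have hx : x ∉ H := fun h' => hy ((h H hH).1.1 h')
    exact ((h H hH).2 hx).symm.trans ((hz H hH).2 hx)
  · intro hz H hH
    refine ⟨(h H hH).1.trans (hz H hH).1, fun hx => ?_⟩
    have hy : y ∉ H := fun h' => hx ((h H hH).1.2 h')
    exact ((h H hH).2 hx).trans ((hz H hH).2 hy)

theorem notMem_arr {d : ℕ} {𝒜 : Finset (Set (Fin d → ℝ))} {x : Fin d → ℝ} :
    x ∉ ArrUnion 𝒜 ↔ ∀ H ∈ 𝒜, x ∉ H := by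
  simp [ArrUnion]

theorem chamber_eq {d : ℕ} {𝒜 : Finset (Set (Fin d → ℝ))} (h𝒜 : IsArrangement 𝒜)
    {x : Fin d → ℝ} (hx : x ∉ ArrUnion 𝒜) :
    connectedComponentIn (ArrUnion 𝒜)ᶜ x = faceOf 𝒜 x := by
  have hx' := notMem_arr.1 hx
  ext y
  constructor
  · intro hy H hH
    have hyA := notMem_arr.1 (connectedComponentIn_subset _ _ hy)
    refine ⟨⟨fun h => absurd h (hx' H hH), fun h => absurd h (hyA H hH)⟩, fun _ => ?_⟩
    apply connectedComponentIn_eq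
    refine connectedComponentIn_mono x ?_ hy
    intro z hz
    exact notMem_arr.1 hz H hH
  · intro hy
    refine (convex_segment x y).isPreconnected.subset_connectedComponentIn
      (left_mem_segment ℝ x y) ?_ (right_mem_segment ℝ x y)
    intro z hz
    refine notMem_arr.2 fun H hH => ?_
    obtain ⟨f, b, -, rfl⟩ := hyp_lin (h𝒜 H hH)
    have h1 := hx' _ hH
    have h2 : f y ≠ b := fun h => h1 ((hy _ hH).1.2 h)
    exact side_seg h1 h2 ((sameSide_iff_s12 h1 h2).1 ((hy _ hH).2 h1)) hz

theorem IsChamber.ex {d : ℕ} {𝒜 : Finset (Set (Fin d → ℝ))} (h𝒜 : IsArrangement 𝒜)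
    {C : Set (Fin d → ℝ)} (hC : IsChamber 𝒜 C) :
    ∃ x, (∀ H ∈ 𝒜, x ∉ H) ∧ C = faceOf 𝒜 x := by
  obtain ⟨x, hx, rfl⟩ := hC
  exact ⟨x, notMem_arr.1 hx, chamber_eq h𝒜 hx⟩

theorem chamber_open {d : ℕ} {𝒜 : Finset (Set (Fin d → ℝ))} (h𝒜 : IsArrangement 𝒜)
    {C : Set (Fin d → ℝ)} (hC : IsChamber 𝒜 C) : IsOpen C := by
  obtain ⟨x, hx, rfl⟩ := hC
  apply IsOpen.connectedComponentIn
  rw [isOpen_compl_iff]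
  refine Set.Finite.isClosed_biUnion 𝒜.finite_toSet fun H hH => ?_
  obtain ⟨f, b, -, rfl⟩ := hyp_lin (h𝒜 H hH)
  exact isClosed_eq (lin_cont f) continuous_const

theorem faceComp_chamber {d : ℕ} {𝒜 : Finset (Set (Fin d → ℝ))} (h𝒜 : IsArrangement 𝒜)
    {C P : Set (Fin d → ℝ)} (hC : IsChamber 𝒜 C) (hP : IsChamber 𝒜 P) :
    faceComp 𝒜 C P = C := by
  obtain ⟨x, hx, hCx⟩ := hC.ex h𝒜
  obtain ⟨p, hp, hPp⟩ := hP.ex h𝒜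
  have hcomp : CompProp C P C := by
    intro y hy z _
    have hc : Continuous fun ε : ℝ => y + ε • (z - y) := by fun_prop
    have ho := (chamber_open h𝒜 hC).preimage hc
    have h0 : (0 : ℝ) ∈ (fun ε : ℝ => y + ε • (z - y)) ⁻¹' C := by simpa using hy
    obtain ⟨r, hr, hb⟩ := Metric.isOpen_iff.1 ho 0 h0
    refine ⟨r, hr, fun ε h1 h2 => hb ?_⟩
    simpa [abs_of_pos h1] using h2
  have huniq : ∀ Q, Q ∈ Faces 𝒜 ∧ CompProp C P Q → Q = C := by
    rintro Q ⟨⟨q, rfl⟩, hQ⟩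
    have hxC : x ∈ C := hCx ▸ mem_faceOf_self 𝒜 x
    have hpP : p ∈ P := hPp ▸ mem_faceOf_self 𝒜 p
    obtain ⟨r, hr, h1⟩ := hQ x hxC p hpP
    obtain ⟨s, hs, h2⟩ := hcomp x hxC p hpP
    have hm : 0 < min r s := lt_min hr hs
    have e1 := h1 (min r s / 2) (by linarith) (by linarith [min_le_left r s])
    have e2 := h2 (min r s / 2) (by linarith) (by linarith [min_le_right r s])
    rw [hCx] at e2 ⊢
    rw [faceOf_eq e1, faceOf_eq e2]
  have h : ∃! Q, Q ∈ Faces 𝒜 ∧ CompProp C P Q := ⟨C, ⟨⟨x, hCx⟩, hcomp⟩, huniq⟩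
  unfold faceComp
  rw [dif_pos h]
  exact huniq _ h.choose_spec.1

/-- A point of the closure of a chamber off a hyperplane is on the same side. -/
theorem side_closure {d : ℕ} {𝒜 : Finset (Set (Fin d → ℝ))} {p x : Fin d → ℝ}
    {f : (Fin d → ℝ) →ₗ[ℝ] ℝ} {b : ℝ} (hH : {z | f z = b} ∈ 𝒜)
    (hp : f p ≠ b) (hx : x ∈ closure (faceOf 𝒜 p)) (hxb : f x ≠ b) :
    b < f p ↔ b < f x := by
  have key : ∀ z ∈ faceOf 𝒜 p, (b < f p ↔ b < f z) := by
    intro z hz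
    have h2 : f z ≠ b := fun h => hp ((hz _ hH).1.2 h)
    exact (sameSide_iff_s12 hp h2).1 ((hz _ hH).2 hp)
  constructor
  · intro h
    have hc : IsClosed {z | b ≤ f z} := isClosed_le continuous_const (lin_cont f)
    have := closure_minimal (fun z hz => ((key z hz).1 h).le) hc hx
    exact lt_of_le_of_ne this hxb.symm
  · intro h
    by_contra h'
    have hc : IsClosed {z | f z ≤ b} := isClosed_le (lin_cont f) continuous_const
    have := closure_minimal (fun z hz => not_lt.1 (fun h3 => h' ((key z hz).2 h3))) hc hx
    exact absurd h (not_lt.2 this)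

theorem chamber_dir {d : ℕ} {𝒜 : Finset (Set (Fin d → ℝ))} {x₀ : Fin d → ℝ}
    (hcodim : Module.finrank ℝ (affineSpan ℝ (faceOf 𝒜 x₀)).direction = d - 1)
    {f : (Fin d → ℝ) →ₗ[ℝ] ℝ} (hf : f ≠ 0) {b : ℝ} (hH : {z | f z = b} ∈ 𝒜)
    (hx : f x₀ = b) : (affineSpan ℝ (faceOf 𝒜 x₀)).direction = LinearMap.ker f := by
  apply Submodule.eq_of_le_of_finrank_eq
  · rw [direction_affineSpan, vectorSpan_def, Submodule.span_le]
    rintro _ ⟨y, hy, z, hz, rfl⟩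
    have h1 : f y = b := (hy _ hH).1.1 hx
    have h2 : f z = b := (hz _ hH).1.1 hx
    simp [h1, h2]
  · have := Module.Dual.finrank_ker_add_one_of_ne_zero hf
    simp only [Module.finrank_fin_fun] at this
    omega

theorem hyp_unique {d : ℕ} {𝒜 : Finset (Set (Fin d → ℝ))} (h𝒜 : IsArrangement 𝒜)
    {x₀ : Fin d → ℝ}
    (hcodim : Module.finrank ℝ (affineSpan ℝ (faceOf 𝒜 x₀)).direction = d - 1)
    {H H' : Set (Fin d → ℝ)} (hH : H ∈ 𝒜) (hH' : H' ∈ 𝒜) (hx : x₀ ∈ H) (hx' : x₀ ∈ H') :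
    H = H' := by
  obtain ⟨f, b, hf, rfl⟩ := hyp_lin (h𝒜 H hH)
  obtain ⟨g, c, hg, rfl⟩ := hyp_lin (h𝒜 H' hH')
  have h := (chamber_dir hcodim hf hH hx).symm.trans (chamber_dir hcodim hg hH' hx')
  simp only [Set.mem_ofPred_eq] at hx hx'
  ext z
  have := SetLike.ext_iff.1 h (z - x₀)
  simpa [hx, hx', sub_eq_zero] using this

/-- Two distinct chambers differ on some hyperplane. -/
theorem chamber_sep {d : ℕ} {𝒜 : Finset (Set (Fin d → ℝ))} {p q : Fin d → ℝ}
    (hp : ∀ H ∈ 𝒜, p ∉ H) (hq : ∀ H ∈ 𝒜, q ∉ H) (hne : faceOf 𝒜 p ≠ faceOf 𝒜 q) :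
    ∃ H ∈ 𝒜, ¬ SameSide H p q := by
  by_contra! h
  apply hne
  apply faceOf_eq
  intro H hH
  exact ⟨⟨fun h => absurd h (hp H hH), fun h => absurd h (hq H hH)⟩, fun _ => h H hH⟩

/-- Hyperplanes separating two chambers around `x₀` contain `x₀`. -/
theorem sep_contains {d : ℕ} {𝒜 : Finset (Set (Fin d → ℝ))} (h𝒜 : IsArrangement 𝒜)
    {x₀ p q : Fin d → ℝ} (hp : ∀ H ∈ 𝒜, p ∉ H) (hq : ∀ H ∈ 𝒜, q ∉ H)
    (hpx : x₀ ∈ closure (faceOf 𝒜 p)) (hqx : x₀ ∈ closure (faceOf 𝒜 q))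
    {H : Set (Fin d → ℝ)} (hH : H ∈ 𝒜) (hs : ¬ SameSide H p q) : x₀ ∈ H := by
  obtain ⟨f, b, hf, rfl⟩ := hyp_lin (h𝒜 H hH)
  by_contra hx
  apply hs
  rw [sameSide_iff_s12 (hp _ hH) (hq _ hH)]
  exact (side_closure hH (hp _ hH) hpx hx).trans (side_closure hH (hq _ hH) hqx hx).symm

theorem separates_iff {d : ℕ} {𝒜 : Finset (Set (Fin d → ℝ))} {p q : Fin d → ℝ}
    (hp : ∀ H ∈ 𝒜, p ∉ H) (hq : ∀ H ∈ 𝒜, q ∉ H) {H : Set (Fin d → ℝ)} (hH : H ∈ 𝒜) :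
    Separates H (faceOf 𝒜 p) (faceOf 𝒜 q) ↔ ¬ SameSide H p q := by
  constructor
  · rintro ⟨x, hx, y, hy, -, -, hs⟩ h
    exact hs ((((hx H hH).2 (hp H hH)).symm.trans h).trans ((hy H hH).2 (hq H hH)))
  · intro h
    exact ⟨p, mem_faceOf_self 𝒜 p, q, mem_faceOf_self 𝒜 q, hp H hH, hq H hH, h⟩

theorem chamber_adj {d : ℕ} {𝒜 : Finset (Set (Fin d → ℝ))} (h𝒜 : IsArrangement 𝒜)
    {F : Set (Fin d → ℝ)} (hF : F ∈ Faces 𝒜)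
    (hcodim : Module.finrank ℝ (affineSpan ℝ F).direction = d - 1)
    {A B : Set (Fin d → ℝ)} (hA : IsChamber 𝒜 A) (hB : IsChamber 𝒜 B)
    (hFA : FaceGE F A) (hFB : FaceGE F B) (hne : A ≠ B) : Adjacent 𝒜 A B := by
  obtain ⟨x₀, rfl⟩ := hF
  obtain ⟨p, hp, rfl⟩ := hA.ex h𝒜
  obtain ⟨q, hq, rfl⟩ := hB.ex h𝒜
  have hx := subset_closure (mem_faceOf_self 𝒜 x₀)
  obtain ⟨H, hH, hs⟩ := chamber_sep hp hq hne
  refine ⟨H, ⟨hH, (separates_iff hp hq hH).2 hs⟩, ?_⟩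
  rintro H' ⟨hH', hs'⟩
  rw [separates_iff hp hq hH'] at hs'
  exact hyp_unique h𝒜 hcodim hH' hH (sep_contains h𝒜 hp hq (hFA hx) (hFB hx) hH' hs')
    (sep_contains h𝒜 hp hq (hFA hx) (hFB hx) hH hs)

theorem chamber_three {d : ℕ} {𝒜 : Finset (Set (Fin d → ℝ))} (h𝒜 : IsArrangement 𝒜)
    {F : Set (Fin d → ℝ)} (hF : F ∈ Faces 𝒜)
    (hcodim : Module.finrank ℝ (affineSpan ℝ F).direction = d - 1)
    {A B C : Set (Fin d → ℝ)} (hA : IsChamber 𝒜 A) (hB : IsChamber 𝒜 B) (hC : IsChamber 𝒜 C)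
    (hFA : FaceGE F A) (hFB : FaceGE F B) (hFC : FaceGE F C) (hne : A ≠ B) :
    C = A ∨ C = B := by
  obtain ⟨x₀, rfl⟩ := hF
  obtain ⟨p, hp, rfl⟩ := hA.ex h𝒜
  obtain ⟨q, hq, rfl⟩ := hB.ex h𝒜
  obtain ⟨r, hr, rfl⟩ := hC.ex h𝒜
  have hx := subset_closure (mem_faceOf_self 𝒜 x₀)
  by_contra! hcon
  obtain ⟨H, hH, hs⟩ := chamber_sep hp hq hne
  obtain ⟨H1, hH1, hs1⟩ := chamber_sep hr hp hcon.1
  obtain ⟨H2, hH2, hs2⟩ := chamber_sep hr hq hcon.2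
  have m := sep_contains h𝒜 hp hq (hFA hx) (hFB hx) hH hs
  have m1 := sep_contains h𝒜 hr hp (hFC hx) (hFA hx) hH1 hs1
  have m2 := sep_contains h𝒜 hr hq (hFC hx) (hFB hx) hH2 hs2
  obtain rfl := hyp_unique h𝒜 hcodim hH hH1 m m1
  obtain rfl := hyp_unique h𝒜 hcodim hH hH2 m m2
  obtain ⟨f, b, hf, rfl⟩ := hyp_lin (h𝒜 H hH)
  rw [sameSide_iff_s12 (hp _ hH) (hq _ hH)] at hs
  rw [sameSide_iff_s12 (hr _ hH) (hp _ hH)] at hs1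
  rw [sameSide_iff_s12 (hr _ hH) (hq _ hH)] at hs2
  tauto

theorem adj_ne {d : ℕ} {𝒜 : Finset (Set (Fin d → ℝ))} (h𝒜 : IsArrangement 𝒜)
    {A B : Set (Fin d → ℝ)} (hA : IsChamber 𝒜 A) (h : Adjacent 𝒜 A B) : A ≠ B := by
  rintro rfl
  obtain ⟨p, hp, rfl⟩ := hA.ex h𝒜
  obtain ⟨H, ⟨hH, hs⟩, -⟩ := h
  exact (separates_iff hp hp hH).1 hs rfl

theorem liftEnd_self {d : ℕ} {𝒜 : Finset (Set (Fin d → ℝ))} {Θ : OrientedGraph}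
    (ρ : GraphMor Θ (chamberGraph 𝒜)) (v : Θ.V) : liftEnd ρ v (ρ.onV v) = v := by
  unfold liftEnd
  split_ifs with h
  · obtain ⟨h1, h2, h3⟩ := h.choose_spec
    set γ := h.choose
    have hl := h2.2 (GWalk.nil _ (ρ.onV v)) (by rw [ρ.mapWalk_start, h1]; rfl) h3.symm
      (by intro s hs; simp [GWalk.nil] at hs)
    have h0 : γ.steps = [] := by
      simpa [GWalk.length, GWalk.nil, GraphMor.mapWalk] using hl
    rw [GWalk.endV, h0]
    exact h1
  · rfl

/-- The walk consisting of one edge. -/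
def edgeWalk (G : OrientedGraph) (e : G.E) : GWalk G :=
  ⟨G.src e, [(e, true)], ⟨rfl, trivial⟩⟩

theorem liftEnd_edge {d : ℕ} {𝒜 : Finset (Set (Fin d → ℝ))} (h𝒜 : IsArrangement 𝒜)
    {Θ : OrientedGraph} {SΓ : OrientedSystem (chamberGraph 𝒜)} {SΘ : OrientedSystem Θ}
    {ρ : GraphMor Θ (chamberGraph 𝒜)} (hcover : IsCoverOS ρ SΘ SΓ) (e : Θ.E) :
    liftEnd ρ (Θ.src e) (ρ.onV (Θ.tgt e)) = Θ.tgt e := by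
  have hadj : ρ.onV (Θ.src e) ≠ ρ.onV (Θ.tgt e) := by
    rw [← ρ.src_comm, ← ρ.tgt_comm]
    intro h
    exact adj_ne h𝒜 (ρ.onE e).1.1.2 (ρ.onE e).2 (congrArg Subtype.val h)
  have hmap : (ρ.mapWalk (edgeWalk Θ e)).endV = ρ.onV (Θ.tgt e) := ρ.mapWalk_endV _
  have hpos : (ρ.mapWalk (edgeWalk Θ e)).Positive := by
    intro s hs
    simp only [GraphMor.mapWalk, edgeWalk, List.map_cons, List.map_nil,
      List.mem_singleton] at hs
    rw [hs]; rfl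
  have hmin : IsMinPos (chamberGraph 𝒜) (ρ.mapWalk (edgeWalk Θ e)) := by
    refine ⟨hpos, ?_⟩
    intro w hw1 hw2 _
    show 1 ≤ w.steps.length
    rw [Nat.one_le_iff_ne_zero]
    intro h0
    have h0' : w.steps = [] := List.length_eq_zero_iff.1 h0
    apply hadj
    have : w.endV = w.start := by rw [GWalk.endV, h0']; rfl
    rw [hw2, hw1, hmap] at this
    exact this.symm
  have h : ∃ γ : GWalk Θ, γ.start = Θ.src e ∧ IsMinPos (chamberGraph 𝒜) (ρ.mapWalk γ) ∧
      (ρ.mapWalk γ).endV = ρ.onV (Θ.tgt e) := ⟨edgeWalk Θ e, rfl, hmin, hmap⟩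
  unfold liftEnd
  rw [dif_pos h]
  obtain ⟨h1, h2, h3⟩ := h.choose_spec
  generalize h.choose = γ at h1 h2 h3
  have hle : γ.steps.length ≤ 1 := by
    have := h2.2 (ρ.mapWalk (edgeWalk Θ e)) (by rw [ρ.mapWalk_start, ρ.mapWalk_start, h1]; rfl)
      (hmap.trans h3.symm) hpos
    simpa [GWalk.length, GraphMor.mapWalk, edgeWalk] using this
  obtain ⟨st, l, hv⟩ := γ
  have h1' : st = Θ.src e := h1
  subst h1'
  match l, hv, hle, h2, h3 with
  | [], hv, _, _, h3 => exact absurd h3 hadj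
  | [(e', false)], hv, _, h2, _ =>
    exact absurd (h2.1 (ρ.onE e', false) (by simp [GraphMor.mapWalk, GraphMor.mapStep])) (by simp)
  | [(e', true)], hv, _, _, h3 =>
    have hs : Θ.src e' = Θ.src e := hv.1
    have ht : ρ.onV (Θ.tgt e') = ρ.onV (Θ.tgt e) := (ρ.mapWalk_endV _).symm.trans h3
    have hee : ρ.onE e' = ρ.onE e := by
      apply Subtype.ext
      apply Prod.ext
      · show (chamberGraph 𝒜).src _ = (chamberGraph 𝒜).src _
        rw [ρ.src_comm, ρ.src_comm, hs]
      · show (chamberGraph 𝒜).tgt _ = (chamberGraph 𝒜).tgt _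
        rw [ρ.tgt_comm, ρ.tgt_comm, ht]
    have hu := (hcover.lift_exists_unique (Θ.src e) (ρ.mapWalk (edgeWalk Θ e)) rfl).unique
      (y₁ := ⟨Θ.src e, [(e', true)], hv⟩) (y₂ := edgeWalk Θ e)
      ⟨rfl, by simp [GraphMor.mapWalk, edgeWalk, GraphMor.mapStep, hee]⟩ ⟨rfl, rfl⟩
    rw [hu]; rfl
  | _ :: _ :: _, _, hle, _, _ => simp at hle

theorem exists_edge {d : ℕ} {𝒜 : Finset (Set (Fin d → ℝ))}
    {Θ : OrientedGraph} {SΓ : OrientedSystem (chamberGraph 𝒜)} {SΘ : OrientedSystem Θ}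
    {ρ : GraphMor Θ (chamberGraph 𝒜)} (hcover : IsCoverOS ρ SΘ SΓ) (v : Θ.V)
    (B : (chamberGraph 𝒜).V) (hadj : Adjacent 𝒜 (ρ.onV v).1 B.1) :
    ∃ e : Θ.E, Θ.src e = v ∧ ρ.onV (Θ.tgt e) = B := by
  let e₀ : (chamberGraph 𝒜).E := ⟨(ρ.onV v, B), hadj⟩
  obtain ⟨⟨st, l, hv⟩, ⟨h1, h2⟩, -⟩ :=
    hcover.lift_exists_unique v (edgeWalk (chamberGraph 𝒜) e₀) rfl
  have hst : l.map ρ.mapStep = [(e₀, true)] := congrArg GWalk.steps h2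
  obtain ⟨s, rfl, hs⟩ := List.map_eq_singleton_iff.1 hst
  obtain ⟨e, bo⟩ := s
  have hb : bo = true := congrArg Prod.snd hs
  subst hb
  have he : ρ.onE e = e₀ := congrArg Prod.fst hs
  refine ⟨e, hv.1.trans h1, ?_⟩
  rw [← ρ.tgt_comm, he]; rfl

theorem plim_iff {d : ℕ} {𝒜 : Finset (Set (Fin d → ℝ))} (h𝒜 : IsArrangement 𝒜)
    {Θ : OrientedGraph} (ρ : GraphMor Θ (chamberGraph 𝒜)) (F : Set (Fin d → ℝ)) (v w : Θ.V) :
    (PlimRhoGE 𝒜 ρ (F, v) ((ρ.onV w).1, w) ∧ (F, v) ≠ ((ρ.onV w).1, w)) ↔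
      FaceGT F (ρ.onV w).1 ∧ w = liftEnd ρ v (ρ.onV w) := by
  have hc := faceComp_chamber h𝒜 (ρ.onV w).2 (ρ.onV v).2
  constructor
  · rintro ⟨⟨h1, h2⟩, h3⟩
    rcases h2 with h2 | ⟨h2, h4, h5⟩
    · exact absurd (Prod.ext h2.1 h2.2) h3
    · refine ⟨⟨h1, h2⟩, ?_⟩
      have : (⟨faceComp 𝒜 (ρ.onV w).1 (ρ.onV v).1, h4⟩ : (chamberGraph 𝒜).V) = ρ.onV w :=
        Subtype.ext hc
      rw [← this]
      exact h5
  · rintro ⟨⟨h1, h2⟩, h3⟩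
    refine ⟨⟨h1, Or.inr ⟨h2, ?_⟩⟩, fun h => h2 (congrArg Prod.fst h)⟩
    have h4 : IsChamber 𝒜 (faceComp 𝒜 (ρ.onV w).1 (ρ.onV v).1) := by
      rw [hc]; exact (ρ.onV w).2
    refine ⟨h4, ?_⟩
    have : (⟨faceComp 𝒜 (ρ.onV w).1 (ρ.onV v).1, h4⟩ : (chamberGraph 𝒜).V) = ρ.onV w :=
      Subtype.ext hc
    show w = liftEnd ρ v ⟨faceComp 𝒜 (ρ.onV w).1 (ρ.onV v).1, h4⟩
    rw [this]
    exact h3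

/-- Let `v₁ ≠ v₂` be vertices of `Θ`, `F` a codimension-1 face and `v` a
vertex with `F > ρ(v)`. Then `(F,v) > (ρ(v₁),v₁)` and `(F,v) > (ρ(v₂),v₂)` hold in
`Plim 𝒟_ρ` iff `F > ρ(v₁)`, `F > ρ(v₂)` and either `v = v₁` and `Θ` has a directed edge
from `v₁` to `v₂`, or `v = v₂` and `Θ` has a directed edge from `v₂` to `v₁`. -/
theorem statement_12 {d : ℕ} (𝒜 : Finset (Set (Fin d → ℝ))) (h𝒜 : IsArrangement 𝒜)
    {Θ : OrientedGraph} (SΓ : OrientedSystem (chamberGraph 𝒜))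
    (hSΓ : IsMinimalSystem (chamberGraph 𝒜) SΓ) (SΘ : OrientedSystem Θ)
    (ρ : GraphMor Θ (chamberGraph 𝒜)) (hcover : IsCoverOS ρ SΘ SΓ)
    (hrelΘ : ∀ γ₁ γ₂ : GWalk Θ, SΘ.rel γ₁ γ₂ ↔
      γ₁.start = γ₂.start ∧ SΓ.rel (ρ.mapWalk γ₁) (ρ.mapWalk γ₂))
    (v₁ v₂ : Θ.V) (hne : v₁ ≠ v₂) (F : Set (Fin d → ℝ)) (hF : F ∈ Faces 𝒜)
    (hcodim : Module.finrank ℝ (affineSpan ℝ F).direction = d - 1)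
    (v : Θ.V) (hFv : FaceGT F (ρ.onV v).1) :
    ((PlimRhoGE 𝒜 ρ (F, v) ((ρ.onV v₁).1, v₁) ∧ (F, v) ≠ ((ρ.onV v₁).1, v₁)) ∧
      (PlimRhoGE 𝒜 ρ (F, v) ((ρ.onV v₂).1, v₂) ∧ (F, v) ≠ ((ρ.onV v₂).1, v₂))) ↔
    (FaceGT F (ρ.onV v₁).1 ∧ FaceGT F (ρ.onV v₂).1 ∧
      ((v = v₁ ∧ ∃ e : Θ.E, Θ.src e = v₁ ∧ Θ.tgt e = v₂) ∨
        (v = v₂ ∧ ∃ e : Θ.E, Θ.src e = v₂ ∧ Θ.tgt e = v₁))) := by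
  rw [plim_iff h𝒜, plim_iff h𝒜]
  constructor
  · rintro ⟨⟨g1, e1⟩, ⟨g2, e2⟩⟩
    refine ⟨g1, g2, ?_⟩
    have hCC : ρ.onV v₁ ≠ ρ.onV v₂ := by
      intro h
      rw [h] at e1
      exact hne (e1.trans e2.symm)
    have hCC' : (ρ.onV v₁).1 ≠ (ρ.onV v₂).1 := fun h => hCC (Subtype.ext h)
    rcases chamber_three h𝒜 hF hcodim (ρ.onV v₁).2 (ρ.onV v₂).2 (ρ.onV v).2 g1.1 g2.1 hFv.1 hCC'
      with h | h
    · left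
      have h' : ρ.onV v = ρ.onV v₁ := Subtype.ext h
      rw [← h', liftEnd_self] at e1
      subst e1
      refine ⟨rfl, ?_⟩
      obtain ⟨e, he1, he2⟩ := exists_edge hcover v₁ (ρ.onV v₂)
        (chamber_adj h𝒜 hF hcodim (ρ.onV v₁).2 (ρ.onV v₂).2 g1.1 g2.1 hCC')
      refine ⟨e, he1, ?_⟩
      rw [← he1, ← he2, liftEnd_edge h𝒜 hcover] at e2
      exact e2.symm
    · right
      have h' : ρ.onV v = ρ.onV v₂ := Subtype.ext h
      rw [← h', liftEnd_self] at e2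
      subst e2
      refine ⟨rfl, ?_⟩
      obtain ⟨e, he1, he2⟩ := exists_edge hcover v₂ (ρ.onV v₁)
        (chamber_adj h𝒜 hF hcodim (ρ.onV v₂).2 (ρ.onV v₁).2 g2.1 g1.1 hCC'.symm)
      refine ⟨e, he1, ?_⟩
      rw [← he1, ← he2, liftEnd_edge h𝒜 hcover] at e1
      exact e1.symm
  · rintro ⟨g1, g2, ⟨rfl, e, rfl, rfl⟩ | ⟨rfl, e, rfl, rfl⟩⟩
    · exact ⟨⟨g1, (liftEnd_self ρ _).symm⟩, ⟨g2, (liftEnd_edge h𝒜 hcover e).symm⟩⟩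
    · exact ⟨⟨g1, (liftEnd_edge h𝒜 hcover e).symm⟩, ⟨g2, (liftEnd_self ρ _).symm⟩⟩

end
end
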